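/- Let N, k, m ≥ 1, let Q be a symmetric positive definite real N×N matrix and μ the Gaussian measure on ℝ^N with mean 0 and covariance Q. Let B, L : ℝ^k → ℝ^N and P : ℝ^N → ℝ^m be linear maps with P∘B = 0, let M be a symmetric k×k matrix, let Γ : ℝ^N → ℝ be convex and continuous, let φ : ℝ^m → ℝ be bounded and Borel measurable, and let r ∈ ℝ. Define R(x) = ∫_{{ξ : Γ(ξ + Bx) ≤ r}} φ(Pξ) exp(−½⟨Mx,x⟩ + ⟨Lx, ξ⟩) μ(dξ). Then R is differentiable at every x ∈ ℝ^k, and for every y ∈ ℝ^k: DR(x)·y = ∫_{{ξ : Γ(ξ + Bx) ≤ r}} φ(Pξ) exp(−½⟨Mx,x⟩ + ⟨Lx, ξ⟩) [ −⟨Mx, y⟩ + ⟨Ly, ξ⟩ − ⟨Lx, By⟩ + ⟨Q^{−1}(By), ξ⟩ ] μ(dξ). -/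

import Mathlib

open MeasureTheory Matrix

/-- The density of the centered Gaussian measure on `ℝ^N` with covariance `Q`:
`(2π)^{−N/2} (det Q)^{−1/2} exp(−½⟨Q⁻¹ξ, ξ⟩)`. -/
noncomputable def gaussDensity {N : ℕ} (Q : Matrix (Fin N) (Fin N) ℝ) (ξ : Fin N → ℝ) :
    ENNReal :=
  ENNReal.ofReal
    (Real.exp (-(1/2) * (Q⁻¹.mulVec ξ ⬝ᵥ ξ)) / Real.sqrt ((2 * Real.pi) ^ N * Q.det))


lemma aux_integrable_gauss {N : ℕ} (hN : 1 ≤ N) (c : ℝ) (hc : 0 < c) :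
    Integrable (fun v : Fin N → ℝ => Real.exp (-c * ‖v‖ ^ 2)) := by
  have hN' : (0 : ℝ) < N := by exact_mod_cast hN
  have h1 : Integrable (fun v : Fin N → ℝ => ∏ i, Real.exp (-(c / N) * (v i) ^ 2)) :=
    Integrable.fintype_prod (f := fun (_ : Fin N) (t : ℝ) => Real.exp (-(c / N) * t ^ 2))
      (fun _ => integrable_exp_neg_mul_sq (by positivity))
  refine h1.mono' (by fun_prop) (Filter.Eventually.of_forall fun v => ?_)
  rw [Real.norm_eq_abs, Real.abs_exp, ← Real.exp_sum]
  apply Real.exp_le_exp.2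
  have h2 : ∑ i, (v i) ^ 2 ≤ N * ‖v‖ ^ 2 := by
    have : ∀ i ∈ (Finset.univ : Finset (Fin N)), (v i) ^ 2 ≤ ‖v‖ ^ 2 := fun i _ => by
      rw [← sq_abs (v i)]
      have := norm_le_pi_norm v i
      rw [Real.norm_eq_abs] at this
      gcongr
    simpa using Finset.sum_le_sum this
  rw [← Finset.mul_sum]
  have h3 : c / N * ∑ i, (v i) ^ 2 ≤ c / N * (N * ‖v‖ ^ 2) := by gcongr
  have h4 : c / N * (N * ‖v‖ ^ 2) = c * ‖v‖ ^ 2 := by field_simp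
  linarith

lemma aux_coercive {N : ℕ} (hN : 1 ≤ N) (A : Matrix (Fin N) (Fin N) ℝ) (hA : A.PosDef) :
    ∃ c : ℝ, 0 < c ∧ ∀ v : Fin N → ℝ, c * ‖v‖ ^ 2 ≤ A.mulVec v ⬝ᵥ v := by
  have : Nonempty (Fin N) := ⟨⟨0, hN⟩⟩
  have hcont : Continuous (fun v : Fin N → ℝ => A.mulVec v ⬝ᵥ v) := by fun_prop
  obtain ⟨v₀, hv₀, hmin⟩ := (isCompact_sphere (0 : Fin N → ℝ) 1).exists_isMinOn
    (NormedSpace.sphere_nonempty.2 zero_le_one) hcont.continuousOn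
  have hv1 : ‖v₀‖ = 1 := by simpa using hv₀
  have hne : v₀ ≠ 0 := by
    intro h; simp [h] at hv1
  refine ⟨A.mulVec v₀ ⬝ᵥ v₀, ?_, fun v => ?_⟩
  · have := hA.dotProduct_mulVec_pos hne
    rw [dotProduct_comm]
    simpa using this
  · by_cases hv : v = 0
    · simp [hv]
    have hvn : ‖v‖ ≠ 0 := norm_ne_zero_iff.2 hv
    have hs : ‖v‖⁻¹ • v ∈ Metric.sphere (0 : Fin N → ℝ) 1 := by
      simp [norm_smul, hvn]
    have h := hmin hs
    simp only [Set.mem_ofPred_eq, mulVec_smul, smul_dotProduct, dotProduct_smul, smul_eq_mul] at h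
    have h2 := mul_le_mul_of_nonneg_right h (sq_nonneg ‖v‖)
    calc _ ≤ _ := h2
      _ = _ := by field_simp

lemma aux_deriv {N k : ℕ} (hN : 1 ≤ N)
    (b : ((Fin k → ℝ) × (Fin N → ℝ)) →L[ℝ] ((Fin k → ℝ) × (Fin N → ℝ)) →L[ℝ] ℝ)
    (c : ℝ) (hc : 0 < c)
    (hb : ∀ η : Fin N → ℝ, b (0, η) (0, η) ≤ -c * ‖η‖ ^ 2)
    (f : (Fin N → ℝ) → ℝ) (hf : Measurable f) (C : ℝ) (hC : ∀ η, |f η| ≤ C)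
    (S : Set (Fin N → ℝ)) (x : Fin k → ℝ) :
    ∃ D : (Fin k → ℝ) →L[ℝ] ℝ,
      HasFDerivAt (fun x' => ∫ η in S, f η * Real.exp (b (x', η) (x', η))) D x ∧
      ∀ y, D y = ∫ η in S, f η * Real.exp (b (x, η) (x, η)) *
        (b (x, η) (y, 0) + b (y, 0) (x, η)) := by
  set ι : (Fin k → ℝ) →L[ℝ] ((Fin k → ℝ) × (Fin N → ℝ)) := ContinuousLinearMap.inl ℝ _ _ with hι
  let a' : (Fin k → ℝ) → (Fin N → ℝ) → ((Fin k → ℝ) →L[ℝ] ℝ) := fun x' η =>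
    (b (x', η)).comp ι + (b.flip (x', η)).comp ι
  let F' : (Fin k → ℝ) → (Fin N → ℝ) → ((Fin k → ℝ) →L[ℝ] ℝ) := fun x' η =>
    (f η * Real.exp (b (x', η) (x', η))) • a' x' η
  have hC0 : 0 ≤ C := (abs_nonneg _).trans (hC 0)
  set ρ : ℝ := ‖x‖ + 1 with hρ
  have hρ0 : 0 ≤ ρ := by positivity
  set β : ℝ := ‖b‖ with hβ
  have hβ0 : 0 ≤ β := norm_nonneg b
  have hι1 : ∀ y, ‖ι y‖ = ‖y‖ := fun y => by simp [hι, Prod.norm_def]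
  have hle : ∀ z w, b z w ≤ β * ‖z‖ * ‖w‖ := fun z w =>
    (le_abs_self _).trans (b.le_opNorm₂ z w)
  have ha : ∀ x' η, ‖x'‖ ≤ ρ →
      b (x', η) (x', η) ≤ β * ρ ^ 2 + 2 * β * ρ * ‖η‖ - c * ‖η‖ ^ 2 := by
    intro x' η hx'
    have e : ((x', η) : (Fin k → ℝ) × (Fin N → ℝ)) = (x', 0) + (0, η) := by simp
    rw [e]
    simp only [map_add, _root_.add_apply]
    have n1 : ‖((x', 0) : (Fin k → ℝ) × (Fin N → ℝ))‖ = ‖x'‖ := by simp [Prod.norm_def]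
    have n2 : ‖((0, η) : (Fin k → ℝ) × (Fin N → ℝ))‖ = ‖η‖ := by simp [Prod.norm_def]
    have h1 := hle (x', 0) (x', 0)
    have h2 := hle (x', 0) (0, η)
    have h3 := hle (0, η) (x', 0)
    have h4 := hb η
    rw [n1] at h1 h2 h3
    rw [n2] at h2 h3
    have g1 : β * ‖x'‖ * ‖x'‖ ≤ β * ρ * ρ := by gcongr
    have g2 : β * ‖x'‖ * ‖η‖ ≤ β * ρ * ‖η‖ := by gcongr
    nlinarith
  have ha' : ∀ x' η, ‖x'‖ ≤ ρ → ‖a' x' η‖ ≤ 2 * β * (ρ + ‖η‖) := by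
    intro x' η hx'
    have hz : ‖((x', η) : (Fin k → ℝ) × (Fin N → ℝ))‖ ≤ ρ + ‖η‖ := by
      rw [Prod.norm_def]
      exact max_le (by simp only; linarith [norm_nonneg η]) (by simp only; linarith)
    refine ContinuousLinearMap.opNorm_le_bound _ (by positivity) fun y => ?_
    have h1 := b.le_opNorm₂ (x', η) (ι y)
    have h2 := b.le_opNorm₂ (ι y) (x', η)
    rw [hι1] at h1 h2
    have g1 : ‖b‖ * ‖((x', η) : (Fin k → ℝ) × (Fin N → ℝ))‖ * ‖y‖ ≤ β * (ρ + ‖η‖) * ‖y‖ := by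
      gcongr
    have h3 : ‖a' x' η y‖ ≤ ‖b (x', η) (ι y)‖ + ‖b (ι y) (x', η)‖ := norm_add_le _ _
    nlinarith
  have hexp : ∀ x' η, ‖x'‖ ≤ ρ → (1 + ρ + ‖η‖) * Real.exp (b (x', η) (x', η)) ≤
      Real.exp (ρ + β * ρ ^ 2 + (2 * β * ρ + 1) ^ 2 / (2 * c)) *
        Real.exp (-(c / 2) * ‖η‖ ^ 2) := by
    intro x' η hx'
    have h1 : 1 + ρ + ‖η‖ ≤ Real.exp (ρ + ‖η‖) := by
      linarith [Real.add_one_le_exp (ρ + ‖η‖)]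
    rw [← Real.exp_add]
    refine (mul_le_mul_of_nonneg_right h1 (Real.exp_pos _).le).trans ?_
    rw [← Real.exp_add]
    apply Real.exp_le_exp.2
    have h2 := ha x' η hx'
    have h3 : (2 * β * ρ + 1) * ‖η‖ ≤ (2 * β * ρ + 1) ^ 2 / (2 * c) + c / 2 * ‖η‖ ^ 2 := by
      have : 0 ≤ ((2 * β * ρ + 1) - c * ‖η‖) ^ 2 / (2 * c) := by positivity
      have e : ((2 * β * ρ + 1) - c * ‖η‖) ^ 2 / (2 * c) =
        (2 * β * ρ + 1) ^ 2 / (2 * c) + c / 2 * ‖η‖ ^ 2 - (2 * β * ρ + 1) * ‖η‖ := by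
        field_simp
        ring
      linarith
    nlinarith
  set K : ℝ := Real.exp (ρ + β * ρ ^ 2 + (2 * β * ρ + 1) ^ 2 / (2 * c)) with hK
  have hK0 : 0 < K := Real.exp_pos _
  have hgint := aux_integrable_gauss hN (c / 2) (by positivity)
  have hmeas : ∀ x', AEStronglyMeasurable (fun η => f η * Real.exp (b (x', η) (x', η)))
      (volume.restrict S) := by
    intro x'
    have : Continuous fun η : Fin N → ℝ => Real.exp (b (x', η) (x', η)) := by fun_prop
    exact (hf.mul this.measurable).aestronglyMeasurable
  have hF'meas : AEStronglyMeasurable (F' x) (volume.restrict S) := by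
    refine (hmeas x).smul ?_
    have : Continuous fun η : Fin N → ℝ => a' x η := by
      simp only [a']
      fun_prop
    exact this.aestronglyMeasurable
  have hxρ : ‖x‖ ≤ ρ := by linarith
  have hF'bd : ∀ x' η, ‖x'‖ ≤ ρ →
      ‖F' x' η‖ ≤ C * (2 * β) * K * Real.exp (-(c / 2) * ‖η‖ ^ 2) := by
    intro x' η hx'
    have e1 : ‖F' x' η‖ = |f η| * Real.exp (b (x', η) (x', η)) * ‖a' x' η‖ := by
      simp only [F']
      rw [norm_smul, norm_mul, Real.norm_eq_abs, Real.norm_eq_abs, Real.abs_exp]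
    rw [e1]
    have h1 := ha' x' η hx'
    have h2 := hexp x' η hx'
    have hE := (Real.exp_pos (b (x', η) (x', η))).le
    calc |f η| * Real.exp (b (x', η) (x', η)) * ‖a' x' η‖
        ≤ C * Real.exp (b (x', η) (x', η)) * (2 * β * (1 + ρ + ‖η‖)) := by
          gcongr
          · exact hC η
          · refine h1.trans ?_
            gcongr
            linarith
      _ = C * (2 * β) * ((1 + ρ + ‖η‖) * Real.exp (b (x', η) (x', η))) := by ring
      _ ≤ C * (2 * β) * (K * Real.exp (-(c / 2) * ‖η‖ ^ 2)) := by gcongr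
      _ = _ := by ring
  have hF'int : Integrable (F' x) (volume.restrict S) :=
    (hgint.const_mul (C * (2 * β) * K)).restrict.mono' hF'meas
      (Filter.Eventually.of_forall fun η => hF'bd x η hxρ)
  refine ⟨∫ η in S, F' x η, ?_, fun y => ?_⟩
  · refine hasFDerivAt_integral_of_dominated_of_fderiv_le (F' := F') (s := Metric.ball x 1)
      (bound := fun η => C * (2 * β) * K * Real.exp (-(c / 2) * ‖η‖ ^ 2))
      (Metric.ball_mem_nhds x one_pos) (Filter.Eventually.of_forall hmeas) ?_ hF'meas ?_
      (hgint.const_mul _).restrict ?_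
    · refine (hgint.const_mul (C * K)).restrict.mono' (hmeas x)
        (Filter.Eventually.of_forall fun η => ?_)
      rw [norm_mul, Real.norm_eq_abs, Real.norm_eq_abs, Real.abs_exp, mul_assoc]
      have h2 := hexp x η hxρ
      have hE := (Real.exp_pos (b (x, η) (x, η))).le
      refine mul_le_mul (hC η) ?_ hE hC0
      refine le_trans ?_ h2
      nlinarith [mul_nonneg (add_nonneg hρ0 (norm_nonneg η)) hE]
    · refine Filter.Eventually.of_forall fun η x' hx' => hF'bd x' η ?_
      have : ‖x' - x‖ < 1 := by simpa [dist_eq_norm] using hx'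
      linarith [norm_le_norm_add_norm_sub x x', norm_sub_rev x x']
    · refine Filter.Eventually.of_forall fun η x' _ => ?_
      have hι' : HasFDerivAt (fun x' : Fin k → ℝ => (x', η)) ι x' := hasFDerivAt_prodMk_left x' η
      have h := b.hasFDerivAt_of_bilinear hι' hι'
      have h2 := (h.exp).const_mul (f η)
      refine h2.congr_fderiv (ContinuousLinearMap.ext fun y => ?_)
      simp [F', a']
      ring
  · rw [ContinuousLinearMap.integral_apply hF'int]
    refine integral_congr_ae (Filter.Eventually.of_forall fun η => ?_)
    simp [F', a', hι]
    ring

lemma aux_shift {N : ℕ} (Q : Matrix (Fin N) (Fin N) ℝ)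
    (Γ : (Fin N → ℝ) → ℝ) (hΓ : Continuous Γ) (r : ℝ) (w : Fin N → ℝ) (h : (Fin N → ℝ) → ℝ) :
    ∫ ξ in {ξ | Γ (ξ + w) ≤ r}, h ξ ∂(volume.withDensity (gaussDensity Q)) =
    ∫ η in {η | Γ η ≤ r}, Real.exp (-(1/2) * (Q⁻¹.mulVec (η - w) ⬝ᵥ (η - w))) /
      Real.sqrt ((2 * Real.pi) ^ N * Q.det) * h (η - w) := by
  have hm1 : MeasurableSet {ξ | Γ (ξ + w) ≤ r} :=
    (isClosed_le (by fun_prop) continuous_const).measurableSet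
  have hm2 : MeasurableSet {ξ | Γ ξ ≤ r} :=
    (isClosed_le (by fun_prop) continuous_const).measurableSet
  have hg : Measurable (gaussDensity Q) := by
    unfold gaussDensity
    refine ENNReal.measurable_ofReal.comp (Continuous.measurable ?_)
    fun_prop
  rw [setIntegral_withDensity_eq_setIntegral_toReal_smul hg
    (Filter.Eventually.of_forall fun ξ => ENNReal.ofReal_lt_top) _ hm1,
    ← integral_indicator hm1, ← integral_indicator hm2, ← integral_sub_right_eq_self _ w]
  congr 1
  ext η
  simp only [Set.indicator_apply, Set.mem_ofPred_eq, sub_add_cancel, smul_eq_mul]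
  unfold gaussDensity
  rw [ENNReal.toReal_ofReal (by positivity)]

/-- Finite-dimensional differentiation formula for the approximating stopped semigroup:
`R(x) = ∫_{{Γ(ξ+Bx) ≤ r}} φ(Pξ) exp(−½⟨Mx,x⟩ + ⟨Lx,ξ⟩) dμ(ξ)` is differentiable with
`DR(x)·y = ∫_{{Γ(ξ+Bx) ≤ r}} φ(Pξ) exp(−½⟨Mx,x⟩ + ⟨Lx,ξ⟩)
  (−⟨Mx,y⟩ + ⟨Ly,ξ⟩ − ⟨Lx,By⟩ + ⟨Q⁻¹(By),ξ⟩) dμ(ξ)`. -/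
theorem stopped_semigroup_derivative (N k m : ℕ) (hN : 1 ≤ N) (hk : 1 ≤ k) (hm : 1 ≤ m)
    (Q : Matrix (Fin N) (Fin N) ℝ) (hQ : Q.PosDef)
    (B L : (Fin k → ℝ) →ₗ[ℝ] (Fin N → ℝ))
    (P : (Fin N → ℝ) →ₗ[ℝ] (Fin m → ℝ)) (hPB : P ∘ₗ B = 0)
    (M : Matrix (Fin k) (Fin k) ℝ) (hM : M.IsSymm)
    (Γ : (Fin N → ℝ) → ℝ) (hΓconv : ConvexOn ℝ Set.univ Γ) (hΓcont : Continuous Γ)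
    (φ : (Fin m → ℝ) → ℝ) (hφmeas : Measurable φ) (hφbdd : ∃ c, ∀ z, |φ z| ≤ c)
    (r : ℝ) :
    ∀ x : Fin k → ℝ,
      DifferentiableAt ℝ
        (fun x' : Fin k → ℝ =>
          ∫ ξ in {ξ | Γ (ξ + B x') ≤ r},
            φ (P ξ) * Real.exp (-(1/2) * (M.mulVec x' ⬝ᵥ x') + (L x' ⬝ᵥ ξ))
            ∂(volume.withDensity (gaussDensity Q))) x ∧
      ∀ y : Fin k → ℝ,
        fderiv ℝ
          (fun x' : Fin k → ℝ =>
            ∫ ξ in {ξ | Γ (ξ + B x') ≤ r},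
              φ (P ξ) * Real.exp (-(1/2) * (M.mulVec x' ⬝ᵥ x') + (L x' ⬝ᵥ ξ))
              ∂(volume.withDensity (gaussDensity Q))) x y
          = ∫ ξ in {ξ | Γ (ξ + B x) ≤ r},
              φ (P ξ) * Real.exp (-(1/2) * (M.mulVec x ⬝ᵥ x) + (L x ⬝ᵥ ξ))
                * (-(M.mulVec x ⬝ᵥ y) + (L y ⬝ᵥ ξ) - (L x ⬝ᵥ B y) + (Q⁻¹.mulVec (B y) ⬝ᵥ ξ))
              ∂(volume.withDensity (gaussDensity Q)) := by
  intro x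
  obtain ⟨C, hC⟩ := hφbdd
  obtain ⟨c, hc, hcoer⟩ := aux_coercive hN Q⁻¹ hQ.inv
  have hAsymm : ∀ u v : Fin N → ℝ, Q⁻¹.mulVec u ⬝ᵥ v = Q⁻¹.mulVec v ⬝ᵥ u := by
    intro u v
    have hT : Q⁻¹ᵀ = Q⁻¹ := by simpa using hQ.inv.isHermitian.eq
    rw [dotProduct_comm, dotProduct_mulVec, ← mulVec_transpose, hT]
  have hMsymm : ∀ u v : Fin k → ℝ, M.mulVec u ⬝ᵥ v = M.mulVec v ⬝ᵥ u := by
    intro u v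
    rw [dotProduct_comm, dotProduct_mulVec, ← mulVec_transpose, hM.eq]
  have hPB' : ∀ x, P (B x) = 0 := fun x => by
    simpa using LinearMap.congr_fun hPB x
  let b₀ : ((Fin k → ℝ) × (Fin N → ℝ)) →ₗ[ℝ] ((Fin k → ℝ) × (Fin N → ℝ)) →ₗ[ℝ] ℝ :=
    LinearMap.mk₂ ℝ (fun z w => -(1/2) * (M.mulVec z.1 ⬝ᵥ w.1) + L z.1 ⬝ᵥ (w.2 - B w.1)
        + -(1/2) * (Q⁻¹.mulVec (z.2 - B z.1) ⬝ᵥ (w.2 - B w.1)))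
      (by intro z z' w
          simp only [Prod.fst_add, Prod.snd_add, map_add, mulVec_add, mulVec_sub,
            add_dotProduct, sub_dotProduct, dotProduct_add, dotProduct_sub]
          ring)
      (by intro t z w
          simp only [Prod.smul_fst, Prod.smul_snd, map_smul, mulVec_smul, mulVec_sub,
            smul_dotProduct, sub_dotProduct, dotProduct_sub, smul_eq_mul]
          ring)
      (by intro z w w'
          simp only [Prod.fst_add, Prod.snd_add, map_add, mulVec_sub,
            sub_dotProduct, dotProduct_add, dotProduct_sub]
          ring)
      (by intro t z w
          simp only [Prod.smul_fst, Prod.smul_snd, map_smul, mulVec_sub,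
            dotProduct_smul, sub_dotProduct, dotProduct_sub, smul_eq_mul]
          ring)
  let b := b₀.toContinuousBilinearMap
  have hbe : ∀ z w, b z w = -(1/2) * (M.mulVec z.1 ⬝ᵥ w.1) + L z.1 ⬝ᵥ (w.2 - B w.1)
        + -(1/2) * (Q⁻¹.mulVec (z.2 - B z.1) ⬝ᵥ (w.2 - B w.1)) := fun z w => rfl
  set s : ℝ := Real.sqrt ((2 * Real.pi) ^ N * Q.det) with hs
  have hP : Measurable P := (LinearMap.continuous_of_finiteDimensional P).measurable
  obtain ⟨D, hD, hDy⟩ := aux_deriv hN b (c / 2) (by positivity)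
    (by intro η
        rw [hbe]
        simp
        have := hcoer η
        linarith)
    (fun η => φ (P η) / s) ((hφmeas.comp hP).div_const s) (C / s)
    (by intro η
        rw [abs_div, abs_of_nonneg (Real.sqrt_nonneg _)]
        exact div_le_div_of_nonneg_right (hC _) (Real.sqrt_nonneg _))
    {η | Γ η ≤ r} x
  have hR : (fun x' : Fin k → ℝ =>
          ∫ ξ in {ξ | Γ (ξ + B x') ≤ r},
            φ (P ξ) * Real.exp (-(1/2) * (M.mulVec x' ⬝ᵥ x') + (L x' ⬝ᵥ ξ))
            ∂(volume.withDensity (gaussDensity Q))) =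
      fun x' => ∫ η in {η | Γ η ≤ r}, φ (P η) / s * Real.exp (b (x', η) (x', η)) := by
    funext x'
    rw [aux_shift Q Γ hΓcont]
    congr 1
    ext η
    simp only [hbe, Real.exp_add, map_sub, hPB', sub_zero, hs]
    ring
  rw [hR]
  refine ⟨hD.differentiableAt, fun y => ?_⟩
  rw [hD.fderiv, hDy, aux_shift Q Γ hΓcont]
  congr 1
  ext η
  have e : b (x, η) (y, 0) + b (y, 0) (x, η) = -(M.mulVec x ⬝ᵥ y) + (L y ⬝ᵥ (η - B x))
      - (L x ⬝ᵥ B y) + (Q⁻¹.mulVec (B y) ⬝ᵥ (η - B x)) := by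
    rw [hbe, hbe]
    simp only [zero_sub, dotProduct_neg, mulVec_neg, neg_dotProduct]
    rw [hMsymm y x, hAsymm (η - B x) (B y)]
    ring
  rw [e]
  simp only [hbe, Real.exp_add, map_sub, hPB', sub_zero, hs]
  ring
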